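/- Let n ∈ ℕ, k ∈ {1,…,n}, and p ∈ [1,∞). Let X be a random vector in ℝ^n whose distribution has a density depending only on ‖x‖_p (a continuous p-radial random vector). Let T be a Haar-distributed random orthogonal n×n matrix and set E = T E_0, where E_0 = span(e_1,…,e_k), and let P_E denote the orthogonal projection of ℝ^n onto E. Let Z = (Z_1,…,Z_n) have i.i.d. coordinates with density f_p and G = (G_1,…,G_n) have i.i.d. standard Gaussian coordinates, with X, T, Z, G all independent. Then ‖P_E X‖_2 has the same distribution as ‖X‖_p · (‖Z‖_2/‖Z‖_p) · (‖(G_1,…,G_k)‖_2/‖G‖_2). -/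

import Mathlib

open MeasureTheory Set Matrix
open scoped ENNReal

/-- The `p`-norm on `ℝ^n`. -/
noncomputable def pnorm {n : ℕ} (p : ℝ) (x : Fin n → ℝ) : ℝ :=
  (∑ i, |x i| ^ p) ^ (1 / p)

/-- The Euclidean norm on `ℝ^n`. -/
noncomputable def euclNorm {n : ℕ} (x : Fin n → ℝ) : ℝ :=
  Real.sqrt (∑ i, x i ^ 2)

/-- The `p`-generalized Gaussian density (for `p = 2` this is the standard Gaussian
density). -/
noncomputable def pGaussianDensity (p : ℝ) (x : ℝ) : ℝ :=
  (2 * p ^ (1 / p) * Real.Gamma (1 + 1 / p))⁻¹ * Real.exp (-|x| ^ p / p)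

/-- The orthogonal projection (as a matrix) onto `E_0 = span(e_1,…,e_k)`. -/
noncomputable def proj0 (n k : ℕ) : Matrix (Fin n) (Fin n) ℝ :=
  Matrix.diagonal (fun i => if (i : ℕ) < k then (1 : ℝ) else 0)

/-- Tonelli's theorem for a product of functions of the single coordinates. -/
theorem lintegral_fin_prod_eq_prod {n : ℕ} (μ : Fin n → Measure ℝ) [∀ i, SigmaFinite (μ i)]
    (f : Fin n → ℝ → ℝ≥0∞) (hf : ∀ i, Measurable (f i)) :
    ∫⁻ x, ∏ i, f i (x i) ∂(Measure.pi μ) = ∏ i, ∫⁻ t, f i t ∂(μ i) := by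
  induction n with
  | zero => simp
  | succ n ih =>
    rw [← ((measurePreserving_piFinSuccAbove μ 0).symm).lintegral_comp_emb
      (MeasurableEquiv.measurableEmbedding _)]
    simp_rw [MeasurableEquiv.piFinSuccAbove_symm_apply, Fin.insertNthEquiv,
      Fin.prod_univ_succ, Fin.insertNth_zero, Equiv.coe_fn_mk, Fin.cons_succ,
      Fin.zero_succAbove, cast_eq, Fin.cons_zero]
    rw [← ih _ _ fun i => hf i.succ]
    exact lintegral_prod_mul (μ := μ 0) (ν := Measure.pi fun i => μ i.succ) (f := f 0)
      (g := fun x : Fin n → ℝ => ∏ i, f i.succ (x i))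
      (hf 0).aemeasurable
      (Finset.measurable_prod _ fun i _ => (hf i.succ).comp (measurable_pi_apply i)).aemeasurable

/-- The product of measures with densities is the measure with the product density. -/
theorem pi_withDensity_ofReal {n : ℕ} (f : ℝ → ℝ) (hf : Measurable f) :
    Measure.pi (fun _ : Fin n => (volume : Measure ℝ).withDensity fun t => ENNReal.ofReal (f t)) =
      (volume : Measure (Fin n → ℝ)).withDensity fun x => ∏ i, ENNReal.ofReal (f (x i)) := by
  refine Measure.pi_eq fun s hs => ?_
  rw [withDensity_apply _ (MeasurableSet.univ_pi hs), volume_pi, Measure.restrict_pi_pi,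
    lintegral_fin_prod_eq_prod _ _ fun _ => hf.ennreal_ofReal]
  exact Finset.prod_congr rfl fun i _ => (withDensity_apply _ (hs i)).symm

theorem measurable_pnorm {n : ℕ} (p : ℝ) : Measurable (pnorm p : (Fin n → ℝ) → ℝ) := by
  unfold pnorm
  fun_prop

theorem pnorm_nonneg {n : ℕ} (p : ℝ) (x : Fin n → ℝ) : 0 ≤ pnorm p x := by
  unfold pnorm
  positivity

theorem pnorm_rpow {n : ℕ} {p : ℝ} (hp : 1 ≤ p) (x : Fin n → ℝ) :
    pnorm p x ^ p = ∑ i, |x i| ^ p := by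
  rw [pnorm, one_div, Real.rpow_inv_rpow (by positivity) (by positivity)]

theorem pnorm_smul {n : ℕ} {p : ℝ} (hp : 1 ≤ p) {c : ℝ} (hc : 0 ≤ c) (x : Fin n → ℝ) :
    pnorm p (c • x) = c * pnorm p x := by
  have h : ∑ i, |(c • x) i| ^ p = c ^ p * ∑ i, |x i| ^ p := by
    simp [abs_mul, Real.mul_rpow, abs_of_nonneg hc, Finset.mul_sum, hc]
  rw [pnorm, h, one_div, Real.mul_rpow (by positivity) (by positivity),
    Real.rpow_rpow_inv hc (by positivity), pnorm, one_div]

theorem abs_le_pnorm {n : ℕ} {p : ℝ} (hp : 1 ≤ p) (x : Fin n → ℝ) (i : Fin n) :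
    |x i| ≤ pnorm p x := by
  rw [← Real.rpow_le_rpow_iff (abs_nonneg _) (pnorm_nonneg p x) (z := p) (by positivity),
    pnorm_rpow hp]
  exact Finset.single_le_sum (f := fun i => |x i| ^ p) (fun _ _ => by positivity)
    (Finset.mem_univ i)

theorem pnorm_pos {n : ℕ} {p : ℝ} (hp : 1 ≤ p) {x : Fin n → ℝ} (hx : x ≠ 0) : 0 < pnorm p x := by
  obtain ⟨i, hi⟩ := Function.ne_iff.1 hx
  exact (abs_pos.2 hi).trans_le (abs_le_pnorm hp x i)

theorem pnorm_two {n : ℕ} (x : Fin n → ℝ) : pnorm 2 x = euclNorm x := by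
  simp [pnorm, euclNorm, Real.sqrt_eq_rpow]

theorem measurable_pGaussianDensity (p : ℝ) : Measurable (pGaussianDensity p) := by
  unfold pGaussianDensity
  fun_prop

/-- A vector with independent `p`-generalized Gaussian coordinates is `p`-radial. -/
theorem pi_pGaussian_eq_withDensity {n : ℕ} {p : ℝ} (hp : 1 ≤ p) :
    ∃ g : ℝ → ℝ≥0∞, Measure.pi (fun _ : Fin n => (volume : Measure ℝ).withDensity
        fun t => ENNReal.ofReal (pGaussianDensity p t)) =
      (volume : Measure (Fin n → ℝ)).withDensity fun x => g (pnorm p x) := by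
  refine ⟨fun r => ENNReal.ofReal ((2 * p ^ (1 / p) * Real.Gamma (1 + 1 / p))⁻¹ ^ n *
    Real.exp (-r ^ p / p)), ?_⟩
  have hC : 0 ≤ (2 * p ^ (1 / p) * Real.Gamma (1 + 1 / p))⁻¹ := by
    have := Real.Gamma_pos_of_pos (show 0 < 1 + 1 / p by positivity)
    positivity
  rw [pi_withDensity_ofReal _ (measurable_pGaussianDensity p)]
  congr 1
  ext x
  rw [← ENNReal.ofReal_prod_of_nonneg (f := fun i => pGaussianDensity p (x i))
    fun i _ => mul_nonneg hC (Real.exp_nonneg _)]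
  beta_reduce
  rw [pnorm_rpow hp]
  simp only [pGaussianDensity, Finset.prod_mul_distrib, ← Real.exp_sum, Finset.prod_const,
    Finset.card_univ, Fintype.card_fin, ← Finset.sum_div, Finset.sum_neg_distrib]

/-- For an arbitrary, possibly non-measurable, density depending only on the second coordinate,
the measure with that density with respect to a product is again a product. -/
theorem prod_withDensity_snd {α β : Type*} [MeasurableSpace α] [MeasurableSpace β]
    (σ : Measure α) [SFinite σ] (ν : Measure β) [SFinite ν] (g : β → ℝ≥0∞) :
    (σ.prod ν).withDensity (fun z => g z.2) = σ.prod (ν.withDensity g) := by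
  obtain ⟨g', hg'm, hg'le, hg'⟩ := exists_measurable_le_withDensity_eq ν g
  obtain ⟨φ, hφm, hφle, hφ⟩ :=
    exists_measurable_le_withDensity_eq (σ.prod ν) (fun z : α × β => g z.2)
  rw [← hg', prod_withDensity_right hg'm]
  refine le_antisymm ?_ (withDensity_mono (ae_of_all _ fun z => hg'le z.2))
  rw [← hφ]
  refine Measure.le_iff.2 fun s hs => ?_
  rw [withDensity_apply _ hs, withDensity_apply _ hs, ← lintegral_indicator hs,
    ← lintegral_indicator hs, lintegral_prod _ (hφm.indicator hs).aemeasurable,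
    lintegral_prod (s.indicator fun z => g' z.2)
      ((hg'm.comp measurable_snd).indicator hs).aemeasurable]
  refine lintegral_mono fun a => ?_
  have hsa : MeasurableSet (Prod.mk a ⁻¹' s) := measurable_prodMk_left hs
  change ∫⁻ b, (Prod.mk a ⁻¹' s).indicator (fun b => φ (a, b)) b ∂ν ≤
    ∫⁻ b, (Prod.mk a ⁻¹' s).indicator g' b ∂ν
  rw [lintegral_indicator hsa, lintegral_indicator hsa, ← withDensity_apply g' hsa, hg',
    withDensity_apply _ hsa]
  exact lintegral_mono fun b => hφle (a, b)

/-- The polar decomposition `x ↦ (x / ‖x‖_p, ‖x‖_p)`. -/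
noncomputable def polar {n : ℕ} (p : ℝ) (x : Fin n → ℝ) : (Fin n → ℝ) × ℝ :=
  ((pnorm p x)⁻¹ • x, pnorm p x)

theorem measurable_polar {n : ℕ} (p : ℝ) :
    Measurable (polar p : (Fin n → ℝ) → (Fin n → ℝ) × ℝ) :=
  ((measurable_pnorm p).inv.smul measurable_id).prodMk (measurable_pnorm p)

theorem snd_smul_fst_polar {n : ℕ} {p : ℝ} (hp : 1 ≤ p) (x : Fin n → ℝ) :
    (polar p x).2 • (polar p x).1 = x := by
  by_cases hx : x = 0
  · simp [hx, polar]
  · exact smul_inv_smul₀ (pnorm_pos hp hx).ne' x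

theorem measurableEmbedding_polar {n : ℕ} {p : ℝ} (hp : 1 ≤ p) :
    MeasurableEmbedding (polar p : (Fin n → ℝ) → (Fin n → ℝ) × ℝ) :=
  (measurable_polar p).measurableEmbedding fun x y h => by
    rw [← snd_smul_fst_polar hp x, h, snd_smul_fst_polar hp y]

theorem fst_polar_smul {n : ℕ} {p : ℝ} (hp : 1 ≤ p) {c : ℝ} (hc : 0 < c) (x : Fin n → ℝ) :
    (polar p (c • x)).1 = (polar p x).1 := by
  simp only [polar, pnorm_smul hp hc.le, smul_smul]
  congr 1
  field_simp

open scoped Pointwise in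
/-- The volume of a truncated cone scales with its radius. -/
theorem volume_cone {n : ℕ} (hn : n ≠ 0) {p : ℝ} (hp : 1 ≤ p) (A : Set (Fin n → ℝ)) (r : ℝ) :
    volume {x : Fin n → ℝ | (polar p x).1 ∈ A ∧ pnorm p x < r} =
      ENNReal.ofReal (max r 0 ^ n) *
        volume {x : Fin n → ℝ | (polar p x).1 ∈ A ∧ pnorm p x < 1} := by
  rcases le_or_gt r 0 with hr | hr
  · have : {x : Fin n → ℝ | (polar p x).1 ∈ A ∧ pnorm p x < r} = ∅ :=
      Set.eq_empty_of_forall_notMem fun x hx =>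
        absurd (hx.2.trans_le hr) (pnorm_nonneg p x).not_gt
    simp [this, hr, hn]
  · have h : {x : Fin n → ℝ | (polar p x).1 ∈ A ∧ pnorm p x < r} =
        r • {x : Fin n → ℝ | (polar p x).1 ∈ A ∧ pnorm p x < 1} := by
      ext x
      rw [Set.mem_smul_set_iff_inv_smul_mem₀ hr.ne']
      simp only [Set.mem_ofPred_eq, fst_polar_smul hp (inv_pos.2 hr),
        pnorm_smul hp (inv_pos.2 hr).le, inv_mul_lt_iff₀ hr, mul_one]
    rw [h, Measure.addHaar_smul, max_eq_left hr.le, Module.finrank_fin_fun,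
      abs_of_nonneg (pow_nonneg hr.le n)]

theorem volume_pnorm_ball_ne_top {n : ℕ} {p : ℝ} (hp : 1 ≤ p) (r : ℝ) :
    volume {x : Fin n → ℝ | pnorm p x < r} ≠ ∞ := by
  refine measure_ne_top_of_subset (fun x hx => ?_)
    (isCompact_Icc (a := fun _ : Fin n => -r) (b := fun _ => r)).measure_ne_top
  have h i : |x i| ≤ r := (abs_le_pnorm hp x i).trans (le_of_lt hx)
  exact ⟨fun i => (abs_le.1 (h i)).1, fun i => (abs_le.1 (h i)).2⟩

theorem volume_pnorm_ball_ne_zero {n : ℕ} {p : ℝ} (hp : 1 ≤ p) :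
    volume {x : Fin n → ℝ | pnorm p x < 1} ≠ 0 := by
  have hc : Continuous (pnorm p : (Fin n → ℝ) → ℝ) := by
    unfold pnorm
    refine (continuous_finsetSum _ fun i _ => ?_).rpow_const fun _ => Or.inr (by positivity)
    exact (continuous_apply i).abs.rpow_const fun _ => Or.inr (by positivity)
  refine (IsOpen.measure_pos _ (isOpen_lt hc continuous_const) ⟨0, ?_⟩).ne'
  have : pnorm p (0 : Fin n → ℝ) = 0 := by simpa using pnorm_smul hp le_rfl (0 : Fin n → ℝ)
  simp [this]

theorem sigmaFinite_map_pnorm {n : ℕ} {p : ℝ} (hp : 1 ≤ p) :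
    SigmaFinite (Measure.map (pnorm p) (volume : Measure (Fin n → ℝ))) := by
  refine ⟨⟨⟨fun m => Iio (m : ℝ), fun _ => trivial, fun m => ?_, ?_⟩⟩⟩
  · rw [Measure.map_apply (measurable_pnorm p) measurableSet_Iio]
    exact (volume_pnorm_ball_ne_top hp m).lt_top
  · exact Set.eq_univ_of_forall fun x => Set.mem_iUnion.2 (exists_nat_gt x)

/-- The cone probability measure: the law of the direction of a uniform point of the unit ball. -/
noncomputable def coneMeasure (n : ℕ) (p : ℝ) : Measure (Fin n → ℝ) :=
  (volume {x : Fin n → ℝ | pnorm p x < 1})⁻¹ •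
    Measure.map (fun x => (polar p x).1) (volume.restrict {x : Fin n → ℝ | pnorm p x < 1})

theorem coneMeasure_apply {n : ℕ} {p : ℝ} {A : Set (Fin n → ℝ)} (hA : MeasurableSet A) :
    coneMeasure n p A = (volume {x : Fin n → ℝ | pnorm p x < 1})⁻¹ *
      volume {x : Fin n → ℝ | (polar p x).1 ∈ A ∧ pnorm p x < 1} := by
  have hm : Measurable fun x : Fin n → ℝ => (polar p x).1 := (measurable_polar p).fst
  rw [coneMeasure, Measure.smul_apply, Measure.map_apply hm hA, Measure.restrict_apply (hm hA)]
  rfl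

theorem isProbabilityMeasure_coneMeasure {n : ℕ} {p : ℝ} (hp : 1 ≤ p) :
    IsProbabilityMeasure (coneMeasure n p) := by
  refine ⟨?_⟩
  rw [coneMeasure_apply MeasurableSet.univ]
  simpa using ENNReal.inv_mul_cancel (volume_pnorm_ball_ne_zero hp) (volume_pnorm_ball_ne_top hp 1)

/-- In polar coordinates, Lebesgue measure is a product measure. -/
theorem map_polar_volume {n : ℕ} (hn : n ≠ 0) {p : ℝ} (hp : 1 ≤ p) :
    Measure.map (polar p) (volume : Measure (Fin n → ℝ)) =
      (coneMeasure n p).prod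
        (Measure.map (pnorm p) (volume : Measure (Fin n → ℝ))) := by
  have := sigmaFinite_map_pnorm (n := n) hp
  have := isProbabilityMeasure_coneMeasure (n := n) hp
  refine (Measure.prod_eq fun A B hA hB => ?_).symm
  have hm : Measurable fun x : Fin n → ℝ => (polar p x).1 := (measurable_polar p).fst
  have key : Measure.map (pnorm p) (volume.restrict ((fun x => (polar p x).1) ⁻¹' A)) =
      coneMeasure n p A • Measure.map (pnorm p) (volume : Measure (Fin n → ℝ)) := by
    refine Measure.ext_of_generateFrom_of_iUnion (range Iio) (fun m : ℕ => Iio (m : ℝ))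
      (borel_eq_generateFrom_Iio ℝ ▸ BorelSpace.measurable_eq) isPiSystem_Iio
      (Set.eq_univ_of_forall fun x => Set.mem_iUnion.2 (exists_nat_gt x))
      (fun m => mem_range_self _) (fun m => ?_) ?_
    · rw [Measure.map_apply (measurable_pnorm p) measurableSet_Iio]
      exact ((Measure.restrict_apply_le _ _).trans_lt (volume_pnorm_ball_ne_top hp m).lt_top).ne
    · rintro _ ⟨r, rfl⟩
      have h₁ : volume (pnorm p ⁻¹' Iio r ∩ (fun x : Fin n → ℝ => (polar p x).1) ⁻¹' A) =
          volume {x : Fin n → ℝ | (polar p x).1 ∈ A ∧ pnorm p x < r} := by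
        rw [Set.inter_comm]; rfl
      have h₂ : volume (pnorm p ⁻¹' Iio r : Set (Fin n → ℝ)) = ENNReal.ofReal (max r 0 ^ n) *
          volume {x : Fin n → ℝ | pnorm p x < 1} := by
        simpa [Set.preimage, Set.mem_Iio] using volume_cone hn hp Set.univ r
      rw [Measure.smul_apply, Measure.map_apply (measurable_pnorm p) measurableSet_Iio,
        Measure.map_apply (measurable_pnorm p) measurableSet_Iio,
        Measure.restrict_apply (measurable_pnorm p measurableSet_Iio), h₁, h₂,
        volume_cone hn hp, coneMeasure_apply hA, smul_eq_mul, mul_mul_mul_comm,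
        mul_comm _ (ENNReal.ofReal _), mul_assoc, mul_left_comm (_)⁻¹,
        ENNReal.inv_mul_cancel (volume_pnorm_ball_ne_zero hp) (volume_pnorm_ball_ne_top hp 1),
        mul_one]
  have h := congrArg (fun m => m B) key
  rw [Measure.smul_apply, Measure.map_apply (measurable_pnorm p) hB,
    Measure.restrict_apply (measurable_pnorm p hB), smul_eq_mul] at h
  rw [← h, Measure.map_apply (measurable_polar p) (hA.prod hB), Set.inter_comm]
  rfl

/-- The direction of a `p`-radial probability measure follows the cone measure and is
independent of the radius. -/
theorem map_polar_withDensity {n : ℕ} (hn : n ≠ 0) {p : ℝ} (hp : 1 ≤ p) (g : ℝ → ℝ≥0∞)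
    {μ : Measure (Fin n → ℝ)} [IsProbabilityMeasure μ]
    (hμ : μ = volume.withDensity fun x => g (pnorm p x)) :
    Measure.map (polar p) μ = (coneMeasure n p).prod (Measure.map (pnorm p) μ) := by
  have := sigmaFinite_map_pnorm (n := n) hp
  have := isProbabilityMeasure_coneMeasure (n := n) hp
  have h : Measure.map (polar p) μ = (coneMeasure n p).prod
      ((Measure.map (pnorm p) (volume : Measure (Fin n → ℝ))).withDensity g) := by
    rw [← prod_withDensity_snd, ← map_polar_volume hn hp]
    ext s hs
    rw [Measure.map_apply (measurable_polar p) hs, hμ,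
      withDensity_apply _ (measurable_polar p hs), withDensity_apply _ hs,
      (measurableEmbedding_polar hp).restrict_map, (measurableEmbedding_polar hp).lintegral_map]
    rfl
  have h₂ := congrArg Measure.snd h
  rw [Measure.snd_prod, Measure.snd, Measure.map_map measurable_snd (measurable_polar p)] at h₂
  rw [h, ← h₂]
  rfl

theorem map_fst_polar {n : ℕ} (hn : n ≠ 0) {p : ℝ} (hp : 1 ≤ p) (g : ℝ → ℝ≥0∞)
    {μ : Measure (Fin n → ℝ)} [IsProbabilityMeasure μ]
    (hμ : μ = volume.withDensity fun x => g (pnorm p x)) :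
    Measure.map (fun x => (polar p x).1) μ = coneMeasure n p := by
  have := Measure.isProbabilityMeasure_map (μ := μ) (measurable_pnorm p).aemeasurable
  have h := congrArg Measure.fst (map_polar_withDensity hn hp g hμ)
  rwa [Measure.fst_prod, Measure.fst, Measure.map_map measurable_fst (measurable_polar p)] at h

theorem lintegral_radial_eq {n : ℕ} (hn : n ≠ 0) {p : ℝ} (hp : 1 ≤ p) (g g' : ℝ → ℝ≥0∞)
    {μ ν : Measure (Fin n → ℝ)} [IsProbabilityMeasure μ] [IsProbabilityMeasure ν]
    (hμ : μ = volume.withDensity fun x => g (pnorm p x))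
    (hν : ν = volume.withDensity fun x => g' (pnorm p x))
    {φ : (Fin n → ℝ) → ℝ≥0∞} (hφ : Measurable φ) :
    ∫⁻ x, φ x ∂μ = ∫⁻ x, ∫⁻ z, φ (pnorm p x • (pnorm p z)⁻¹ • z) ∂ν ∂μ := by
  have := isProbabilityMeasure_coneMeasure (n := n) hp
  have := Measure.isProbabilityMeasure_map (μ := μ) (measurable_pnorm p).aemeasurable
  have hφ' : Measurable fun q : (Fin n → ℝ) × ℝ => φ (q.2 • q.1) :=
    hφ.comp (measurable_snd.smul measurable_fst)
  calc ∫⁻ x, φ x ∂μ = ∫⁻ x, φ ((polar p x).2 • (polar p x).1) ∂μ := by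
        simp_rw [snd_smul_fst_polar hp]
    _ = ∫⁻ q, φ (q.2 • q.1) ∂(Measure.map (polar p) μ) :=
        (lintegral_map hφ' (measurable_polar p)).symm
    _ = ∫⁻ r, ∫⁻ y, φ (r • y) ∂(coneMeasure n p) ∂(Measure.map (pnorm p) μ) := by
        rw [map_polar_withDensity hn hp g hμ, lintegral_prod_symm' _ hφ']
    _ = ∫⁻ x, ∫⁻ y, φ (pnorm p x • y) ∂(coneMeasure n p) ∂μ :=
        lintegral_map hφ'.lintegral_prod_left' (measurable_pnorm p)
    _ = _ := by
        refine lintegral_congr fun x => ?_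
        rw [← map_fst_polar hn hp g' hν]
        exact lintegral_map (hφ.comp (measurable_const_smul _)) (measurable_polar p).fst

theorem measurable_euclNorm {n : ℕ} : Measurable (euclNorm : (Fin n → ℝ) → ℝ) := by
  unfold euclNorm
  fun_prop

theorem euclNorm_smul {n : ℕ} {c : ℝ} (hc : 0 ≤ c) (x : Fin n → ℝ) :
    euclNorm (c • x) = c * euclNorm x := by
  rw [← pnorm_two, ← pnorm_two, pnorm_smul one_le_two hc]

theorem euclNorm_pos {n : ℕ} {x : Fin n → ℝ} (hx : x ≠ 0) : 0 < euclNorm x :=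
  pnorm_two x ▸ pnorm_pos one_le_two hx

theorem euclNorm_eq_sqrt_dotProduct {n : ℕ} (x : Fin n → ℝ) : euclNorm x = √(x ⬝ᵥ x) := by
  simp [euclNorm, dotProduct, sq]

theorem euclNorm_mulVec {n : ℕ} {O : Matrix (Fin n) (Fin n) ℝ} (hO : Oᵀ * O = 1)
    (x : Fin n → ℝ) : euclNorm (O *ᵥ x) = euclNorm x := by
  rw [euclNorm_eq_sqrt_dotProduct, euclNorm_eq_sqrt_dotProduct, dotProduct_mulVec,
    vecMul_mulVec, hO, vecMul_one]

/-- The Euclidean norm of the first `k` coordinates. -/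
noncomputable def headNorm {n : ℕ} (k : ℕ) (x : Fin n → ℝ) : ℝ :=
  √(∑ i : Fin n, if (i : ℕ) < k then x i ^ 2 else 0)

theorem measurable_headNorm {n : ℕ} (k : ℕ) : Measurable (headNorm k : (Fin n → ℝ) → ℝ) := by
  unfold headNorm
  refine (Finset.measurable_sum _ fun i _ => ?_).sqrt
  split_ifs <;> fun_prop

theorem euclNorm_proj0_mulVec {n : ℕ} (k : ℕ) (x : Fin n → ℝ) :
    euclNorm (proj0 n k *ᵥ x) = headNorm k x := by
  simp [euclNorm, proj0, headNorm, mulVec_diagonal, ite_pow]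

theorem headNorm_smul {n : ℕ} (k : ℕ) {c : ℝ} (hc : 0 ≤ c) (x : Fin n → ℝ) :
    headNorm k (c • x) = c * headNorm k x := by
  rw [← euclNorm_proj0_mulVec, mulVec_smul, euclNorm_smul hc, euclNorm_proj0_mulVec]

/-- The orthogonal group acts transitively on Euclidean spheres. -/
theorem exists_orthogonal_mulVec_eq {n : ℕ} {x y : Fin n → ℝ} (h : euclNorm x = euclNorm y) :
    ∃ O : Matrix (Fin n) (Fin n) ℝ, Oᵀ * O = 1 ∧ O *ᵥ x = y := by
  by_cases hxy : x - y = 0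
  · exact ⟨1, by simp, by simpa using sub_eq_zero.1 hxy⟩
  have hnn (z : Fin n → ℝ) : 0 ≤ z ⬝ᵥ z := Finset.sum_nonneg fun i _ => mul_self_nonneg (z i)
  rw [euclNorm_eq_sqrt_dotProduct, euclNorm_eq_sqrt_dotProduct,
    Real.sqrt_inj (hnn x) (hnn y)] at h
  have hw : (x - y) ⬝ᵥ (x - y) ≠ 0 := fun h0 => hxy (dotProduct_self_eq_zero.1 h0)
  have hwx : (x - y) ⬝ᵥ (x - y) = 2 * ((x - y) ⬝ᵥ x) := by
    simp only [sub_dotProduct, dotProduct_sub, dotProduct_comm y x]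
    linarith
  generalize hwe : x - y = w at *
  refine ⟨1 - (2 / (w ⬝ᵥ w)) • vecMulVec w w, ?_, ?_⟩
  · have hsq : vecMulVec w w * vecMulVec w w = (w ⬝ᵥ w) • vecMulVec w w := by
      rw [vecMulVec_mul_vecMulVec, vecMulVec_smul]
    simp only [transpose_sub, transpose_one, transpose_smul, transpose_vecMulVec, mul_sub, sub_mul,
      one_mul, mul_one, smul_mul_assoc, mul_smul_comm, hsq, smul_smul]
    rw [div_mul_cancel₀ _ hw]
    module
  · rw [sub_mulVec, one_mulVec, smul_mulVec, vecMulVec_mulVec]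
    have : 2 / (w ⬝ᵥ w) * (w ⬝ᵥ x) = 1 := by
      rw [div_mul_eq_mul_div, ← hwx, div_self hw]
    simp only [op_smul_eq_smul, smul_smul, this, one_smul]
    rw [← hwe, sub_sub_cancel]

/-- A measure whose density depends only on the Euclidean norm is rotation invariant. -/
theorem map_mulVec_withDensity {n : ℕ} (g : ℝ → ℝ≥0∞) {O : Matrix (Fin n) (Fin n) ℝ}
    (hO : Oᵀ * O = 1) :
    Measure.map (fun x => O *ᵥ x) (volume.withDensity fun x => g (euclNorm x)) =
      (volume : Measure (Fin n → ℝ)).withDensity fun x => g (euclNorm x) := by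
  have hm : Measurable fun x : Fin n → ℝ => O *ᵥ x :=
    (Continuous.matrix_mulVec continuous_const continuous_id).measurable
  have he : MeasurableEmbedding fun x : Fin n → ℝ => O *ᵥ x := by
    refine hm.measurableEmbedding fun x y hxy => ?_
    simpa [mulVec_mulVec, hO] using congrArg (fun z => Oᵀ *ᵥ z) hxy
  have hdet : |O.det| = 1 := by
    have h := congrArg det hO
    rw [det_mul, det_transpose, det_one] at h
    rcases mul_self_eq_one_iff.1 h with h | h <;> simp [h]
  have hvol : Measure.map (fun x : Fin n → ℝ => O *ᵥ x) volume = volume := by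
    have h := Real.map_matrix_volume_pi_eq_smul_volume_pi (M := O)
      (fun h0 => by simp [h0] at hdet)
    rw [abs_inv, hdet, inv_one, ENNReal.ofReal_one, one_smul] at h
    exact h
  ext s hs
  rw [Measure.map_apply hm hs, withDensity_apply _ (hm hs), withDensity_apply _ hs]
  conv_rhs => rw [← hvol, he.restrict_map, he.lintegral_map]
  simp_rw [euclNorm_mulVec hO]

section Haar

variable {n : ℕ} {Ω : Type*} [MeasurableSpace Ω] {P : Measure Ω}
  {T : Ω → (Fin n → Fin n → ℝ)}

theorem measurable_headNorm_transpose_mulVec {α : Type*} [MeasurableSpace α]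
    {S : α → (Fin n → Fin n → ℝ)} {x : α → (Fin n → ℝ)} (hS : Measurable S) (hx : Measurable x)
    (k : ℕ) : Measurable fun a => headNorm k ((Matrix.of (S a))ᵀ *ᵥ x a) := by
  refine (measurable_headNorm k).comp (measurable_pi_lambda _ fun i => ?_)
  simp only [mulVec, dotProduct, transpose_apply, of_apply]
  fun_prop

theorem lintegral_haar_congr (hT : Measurable T)
    (hTHaar : ∀ O : Matrix (Fin n) (Fin n) ℝ, Oᵀ * O = 1 →
      Measure.map (fun ω => (fun i j => (O * Matrix.of (T ω)) i j)) P = Measure.map T P)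
    (k : ℕ) {φ : ℝ → ℝ≥0∞} (hφ : Measurable φ) {x y : Fin n → ℝ} (hxy : euclNorm x = euclNorm y) :
    ∫⁻ ω, φ (headNorm k ((Matrix.of (T ω))ᵀ *ᵥ x)) ∂P =
      ∫⁻ ω, φ (headNorm k ((Matrix.of (T ω))ᵀ *ᵥ y)) ∂P := by
  obtain ⟨O, hO, rfl⟩ := exists_orthogonal_mulVec_eq hxy
  have hψ : Measurable fun S : Fin n → Fin n → ℝ => φ (headNorm k ((Matrix.of S)ᵀ *ᵥ x)) :=
    hφ.comp (measurable_headNorm_transpose_mulVec (S := fun S => S) measurable_id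
      measurable_const k)
  have hm : Measurable fun ω => (fun i j => (Oᵀ * Matrix.of (T ω)) i j) := by
    refine measurable_pi_lambda _ fun i => measurable_pi_lambda _ fun j => ?_
    simp only [mul_apply, transpose_apply, of_apply]
    fun_prop
  calc ∫⁻ ω, φ (headNorm k ((Matrix.of (T ω))ᵀ *ᵥ x)) ∂P
      = ∫⁻ S, φ (headNorm k ((Matrix.of S)ᵀ *ᵥ x)) ∂(Measure.map T P) := (lintegral_map hψ hT).symm
    _ = ∫⁻ S, φ (headNorm k ((Matrix.of S)ᵀ *ᵥ x))
          ∂(Measure.map (fun ω => (fun i j => (Oᵀ * Matrix.of (T ω)) i j)) P) := by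
        rw [hTHaar Oᵀ (by rwa [transpose_transpose, mul_eq_one_comm])]
    _ = ∫⁻ ω, φ (headNorm k ((Oᵀ * Matrix.of (T ω))ᵀ *ᵥ x)) ∂P := lintegral_map hψ hm
    _ = _ := by simp_rw [transpose_mul, transpose_transpose, mulVec_mulVec]

/-- The norm of the projection of a fixed vector onto a Haar random subspace, in terms of a
rotation invariant vector. -/
theorem lintegral_haar_headNorm [IsProbabilityMeasure P] (hn : n ≠ 0) (hT : Measurable T)
    (hTorth : ∀ ω, (Matrix.of (T ω))ᵀ * Matrix.of (T ω) = 1)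
    (hTHaar : ∀ O : Matrix (Fin n) (Fin n) ℝ, Oᵀ * O = 1 →
      Measure.map (fun ω => (fun i j => (O * Matrix.of (T ω)) i j)) P = Measure.map T P)
    (k : ℕ) {γ : Measure (Fin n → ℝ)} [IsProbabilityMeasure γ] {g : ℝ → ℝ≥0∞}
    (hγ : γ = volume.withDensity fun x => g (euclNorm x))
    {φ : ℝ → ℝ≥0∞} (hφ : Measurable φ) (x : Fin n → ℝ) :
    ∫⁻ ω, φ (headNorm k ((Matrix.of (T ω))ᵀ *ᵥ x)) ∂P =
      ∫⁻ y, φ (euclNorm x * (headNorm k y / euclNorm y)) ∂γ := by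
  have hx : 0 ≤ euclNorm x := Real.sqrt_nonneg _
  have hTorth' ω : (Matrix.of (T ω))ᵀᵀ * (Matrix.of (T ω))ᵀ = 1 := by
    rw [transpose_transpose, mul_eq_one_comm, hTorth ω]
  have hne : ∀ᵐ y ∂γ, y ≠ 0 := by
    have : Nonempty (Fin n) := ⟨⟨0, Nat.pos_of_ne_zero hn⟩⟩
    rw [hγ]
    refine (withDensity_absolutelyContinuous _ _).ae_le ?_
    exact compl_mem_ae_iff.2 (measure_singleton 0)
  have hstep : ∀ᵐ y ∂γ, ∫⁻ ω, φ (headNorm k ((Matrix.of (T ω))ᵀ *ᵥ x)) ∂P =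
      ∫⁻ ω, φ (euclNorm x * (headNorm k ((Matrix.of (T ω))ᵀ *ᵥ y) /
        euclNorm ((Matrix.of (T ω))ᵀ *ᵥ y))) ∂P := by
    filter_upwards [hne] with y hy
    have hy := euclNorm_pos hy
    have hc : 0 ≤ euclNorm x / euclNorm y := by positivity
    rw [lintegral_haar_congr hT hTHaar k hφ (y := (euclNorm x / euclNorm y) • y)
      (by rw [euclNorm_smul hc, div_mul_cancel₀ _ hy.ne'])]
    refine lintegral_congr fun ω => ?_
    rw [mulVec_smul, headNorm_smul k hc, euclNorm_mulVec (hTorth' ω), div_mul_eq_mul_div,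
      mul_div_assoc]
  have hR : Measurable fun y : Fin n → ℝ => φ (euclNorm x * (headNorm k y / euclNorm y)) :=
    hφ.comp (((measurable_headNorm k).div measurable_euclNorm).const_mul _)
  calc _ = ∫⁻ _, ∫⁻ ω, φ (headNorm k ((Matrix.of (T ω))ᵀ *ᵥ x)) ∂P ∂γ := by simp
    _ = ∫⁻ y, ∫⁻ ω, φ (euclNorm x * (headNorm k ((Matrix.of (T ω))ᵀ *ᵥ y) /
        euclNorm ((Matrix.of (T ω))ᵀ *ᵥ y))) ∂P ∂γ := lintegral_congr_ae hstep
    _ = ∫⁻ ω, ∫⁻ y, φ (euclNorm x * (headNorm k ((Matrix.of (T ω))ᵀ *ᵥ y) /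
        euclNorm ((Matrix.of (T ω))ᵀ *ᵥ y))) ∂γ ∂P := by
        refine lintegral_lintegral_swap (hR.comp (measurable_pi_lambda _ fun i => ?_)).aemeasurable
        simp only [mulVec, dotProduct, transpose_apply, of_apply]
        fun_prop
    _ = ∫⁻ ω, ∫⁻ y, φ (euclNorm x * (headNorm k y / euclNorm y)) ∂γ ∂P := by
        refine lintegral_congr fun ω => ?_
        have hm : Measurable fun y : Fin n → ℝ => (Matrix.of (T ω))ᵀ *ᵥ y :=
          (Continuous.matrix_mulVec continuous_const continuous_id).measurable
        conv_rhs => rw [hγ, ← map_mulVec_withDensity g (hTorth' ω), ← hγ, lintegral_map hR hm]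
    _ = _ := by simp

end Haar

section Independence

variable {Ω α β γ δ : Type*} [MeasurableSpace Ω] [MeasurableSpace α] [MeasurableSpace β]
  [MeasurableSpace γ] [MeasurableSpace δ] {P : Measure Ω} {μ : Measure α} {ν : Measure β}
  {ρ : Measure γ} {τ : Measure δ} [IsProbabilityMeasure ν] [IsProbabilityMeasure ρ]
  [IsProbabilityMeasure τ] {X : Ω → α} {T : Ω → β} {Z : Ω → γ} {G : Ω → δ}

theorem lintegral_fst_snd_of_map_eq_prod (hquad : Measurable fun ω => (X ω, T ω, Z ω, G ω))
    (hindep : Measure.map (fun ω => (X ω, T ω, Z ω, G ω)) P = μ.prod (ν.prod (ρ.prod τ)))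
    (F : α → β → ℝ≥0∞) (hF : Measurable fun q : α × β => F q.1 q.2) :
    ∫⁻ ω, F (X ω) (T ω) ∂P = ∫⁻ x, ∫⁻ t, F x t ∂ν ∂μ := by
  have hΦ : Measurable fun q : α × β × γ × δ => F q.1 q.2.1 :=
    hF.comp (measurable_fst.prodMk (measurable_fst.comp measurable_snd))
  refine (lintegral_map hΦ hquad).symm.trans ?_
  rw [hindep, lintegral_prod _ hΦ.aemeasurable]
  refine lintegral_congr fun x => ?_
  refine (lintegral_prod _ (hΦ.comp measurable_prodMk_left).aemeasurable).trans ?_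
  simp

theorem lintegral_fst_third_fourth_of_map_eq_prod
    (hquad : Measurable fun ω => (X ω, T ω, Z ω, G ω))
    (hindep : Measure.map (fun ω => (X ω, T ω, Z ω, G ω)) P = μ.prod (ν.prod (ρ.prod τ)))
    (F : α → γ → δ → ℝ≥0∞) (hF : Measurable fun q : α × γ × δ => F q.1 q.2.1 q.2.2) :
    ∫⁻ ω, F (X ω) (Z ω) (G ω) ∂P = ∫⁻ x, ∫⁻ z, ∫⁻ y, F x z y ∂τ ∂ρ ∂μ := by
  have hΨ : Measurable fun q : α × β × γ × δ => F q.1 q.2.2.1 q.2.2.2 :=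
    hF.comp (measurable_fst.prodMk (measurable_snd.comp measurable_snd))
  refine (lintegral_map hΨ hquad).symm.trans ?_
  rw [hindep, lintegral_prod _ hΨ.aemeasurable]
  refine lintegral_congr fun x => ?_
  refine (lintegral_prod _ (hΨ.comp measurable_prodMk_left).aemeasurable).trans ?_
  simp only [Function.comp_apply, lintegral_const, measure_univ, mul_one]
  have hx : Measurable fun q : γ × δ => F x q.1 q.2 := hF.comp measurable_prodMk_left
  exact lintegral_prod _ hx.aemeasurable

end Independence

/-- Probabilistic representation of the Euclidean norm of the orthogonal projection of a
continuous `p`-radial random vector `X` onto a uniform (Haar) random `k`-dimensional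
subspace `E = T E_0`:
`‖P_E X‖_2` has the same distribution as
`‖X‖_p (‖Z‖_2/‖Z‖_p)(‖(G_1,…,G_k)‖_2/‖G‖_2)`,
with `Z` having i.i.d. `f_p`-distributed coordinates, `G` standard Gaussian, and
`X, T, Z, G` independent. -/
theorem projection_probabilistic_representation
    (n k : ℕ) (hk1 : 1 ≤ k) (hkn : k ≤ n) (p : ℝ) (hp : 1 ≤ p)
    {Ω : Type*} [MeasurableSpace Ω] (P : Measure Ω) [IsProbabilityMeasure P]
    (X : Ω → (Fin n → ℝ)) (T : Ω → (Fin n → Fin n → ℝ))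
    (Z : Ω → (Fin n → ℝ)) (G : Ω → (Fin n → ℝ))
    (hX : Measurable X) (hT : Measurable T) (hZ : Measurable Z) (hG : Measurable G)
    -- `X` is continuous `p`-radial, i.e. has a density depending only on `‖·‖_p`:
    (g : ℝ → ℝ≥0∞)
    (hXlaw : Measure.map X P = volume.withDensity (fun x => g (pnorm p x)))
    -- `T` takes values in the orthogonal group:
    (hTorth : ∀ ω, (Matrix.of (T ω))ᵀ * Matrix.of (T ω) = 1)
    -- `T` is Haar-distributed: its law is invariant under left multiplication by any
    -- orthogonal matrix:
    (hTHaar : ∀ O : Matrix (Fin n) (Fin n) ℝ, Oᵀ * O = 1 →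
      Measure.map (fun ω => (fun i j => (O * Matrix.of (T ω)) i j)) P =
        Measure.map T P)
    -- the coordinates of `Z` are i.i.d. with density `f_p`:
    (hZlaw : Measure.map Z P =
      Measure.pi (fun _ : Fin n => volume.withDensity
        (fun x => ENNReal.ofReal (pGaussianDensity p x))))
    -- the coordinates of `G` are i.i.d. standard Gaussian:
    (hGlaw : Measure.map G P =
      Measure.pi (fun _ : Fin n => volume.withDensity
        (fun x => ENNReal.ofReal (pGaussianDensity 2 x))))
    -- `X`, `T`, `Z`, `G` are (mutually) independent:
    (hindep : Measure.map (fun ω => (X ω, T ω, Z ω, G ω)) P =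
      (Measure.map X P).prod ((Measure.map T P).prod
        ((Measure.map Z P).prod (Measure.map G P)))) :
    Measure.map (fun ω =>
        euclNorm ((Matrix.of (T ω) * proj0 n k * (Matrix.of (T ω))ᵀ).mulVec (X ω))) P =
      Measure.map (fun ω =>
        pnorm p (X ω) * (euclNorm (Z ω) / pnorm p (Z ω)) *
          (Real.sqrt (∑ i : Fin n, if (i : ℕ) < k then G ω i ^ 2 else 0) / euclNorm (G ω))) P := by
  have hn : n ≠ 0 := by omega
  have := Measure.isProbabilityMeasure_map (μ := P) hX.aemeasurable
  have := Measure.isProbabilityMeasure_map (μ := P) hT.aemeasurable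
  have := Measure.isProbabilityMeasure_map (μ := P) hZ.aemeasurable
  have := Measure.isProbabilityMeasure_map (μ := P) hG.aemeasurable
  obtain ⟨gZ, hgZ⟩ := pi_pGaussian_eq_withDensity (n := n) hp
  obtain ⟨gG, hgG⟩ := pi_pGaussian_eq_withDensity (n := n) one_le_two
  rw [hgZ] at hZlaw
  rw [hgG] at hGlaw
  simp_rw [pnorm_two] at hGlaw
  have hquad : Measurable fun ω => (X ω, T ω, Z ω, G ω) :=
    hX.prodMk (hT.prodMk (hZ.prodMk hG))
  have hR : Measurable fun y : Fin n → ℝ => headNorm k y / euclNorm y :=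
    (measurable_headNorm k).div measurable_euclNorm
  have hleft ω : euclNorm ((Matrix.of (T ω) * proj0 n k * (Matrix.of (T ω))ᵀ).mulVec (X ω)) =
      headNorm k ((Matrix.of (T ω))ᵀ *ᵥ X ω) := by
    rw [mul_assoc, ← mulVec_mulVec, euclNorm_mulVec (hTorth ω), ← mulVec_mulVec,
      euclNorm_proj0_mulVec]
  simp_rw [hleft]
  have hQ : Measurable fun q : (Fin n → ℝ) × (Fin n → ℝ) × (Fin n → ℝ) =>
      pnorm p q.1 * (euclNorm q.2.1 / pnorm p q.2.1) * (headNorm k q.2.2 / euclNorm q.2.2) :=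
    (((measurable_pnorm p).comp measurable_fst).mul ((measurable_euclNorm.div
      (measurable_pnorm p)).comp (measurable_fst.comp measurable_snd))).mul
      (hR.comp (measurable_snd.comp measurable_snd))
  refine Measure.ext_of_lintegral _ fun φ hφ => ?_
  refine (lintegral_map hφ (measurable_headNorm_transpose_mulVec hT hX k)).trans
    (Eq.trans ?_ (lintegral_map hφ (hQ.comp (hX.prodMk (hZ.prodMk hG)))).symm)
  have hrad : Measurable fun x : Fin n → ℝ =>
      ∫⁻ y, φ (euclNorm x * (headNorm k y / euclNorm y)) ∂(Measure.map G P) := by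
    refine Measurable.lintegral_prod_right' (f := fun q : (Fin n → ℝ) × (Fin n → ℝ) =>
      φ (euclNorm q.1 * (headNorm k q.2 / euclNorm q.2))) ?_
    exact hφ.comp ((measurable_euclNorm.comp measurable_fst).mul (hR.comp measurable_snd))
  have hΦ : Measurable fun q : (Fin n → ℝ) × (Fin n → Fin n → ℝ) =>
      headNorm k ((Matrix.of q.2)ᵀ *ᵥ q.1) :=
    measurable_headNorm_transpose_mulVec measurable_snd measurable_fst k
  calc ∫⁻ ω, φ (headNorm k ((Matrix.of (T ω))ᵀ *ᵥ X ω)) ∂P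
      = ∫⁻ x, ∫⁻ S, φ (headNorm k ((Matrix.of S)ᵀ *ᵥ x)) ∂(Measure.map T P)
          ∂(Measure.map X P) :=
        lintegral_fst_snd_of_map_eq_prod hquad hindep
          (fun x S => φ (headNorm k ((Matrix.of S)ᵀ *ᵥ x))) (hφ.comp hΦ)
    _ = ∫⁻ x, ∫⁻ y, φ (euclNorm x * (headNorm k y / euclNorm y)) ∂(Measure.map G P)
          ∂(Measure.map X P) := by
        refine lintegral_congr fun x => ?_
        rw [lintegral_map (f := fun S => φ (headNorm k ((Matrix.of S)ᵀ *ᵥ x)))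
          (hφ.comp (measurable_headNorm_transpose_mulVec (S := fun S => S) measurable_id
            measurable_const k)) hT,
          lintegral_haar_headNorm hn hT hTorth hTHaar k hGlaw hφ x]
    _ = ∫⁻ x, ∫⁻ z, ∫⁻ y, φ (pnorm p x * (euclNorm z / pnorm p z) * (headNorm k y / euclNorm y))
          ∂(Measure.map G P) ∂(Measure.map Z P) ∂(Measure.map X P) := by
        rw [lintegral_radial_eq hn hp g gZ hXlaw hZlaw hrad]
        simp_rw [euclNorm_smul (pnorm_nonneg p _),
          euclNorm_smul (inv_nonneg.2 (pnorm_nonneg p _)), inv_mul_eq_div]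
    _ = ∫⁻ ω, φ (pnorm p (X ω) * (euclNorm (Z ω) / pnorm p (Z ω)) *
          (headNorm k (G ω) / euclNorm (G ω))) ∂P :=
        (lintegral_fst_third_fourth_of_map_eq_prod hquad hindep
          (fun x z y => φ (pnorm p x * (euclNorm z / pnorm p z) * (headNorm k y / euclNorm y)))
          (hφ.comp hQ)).symm
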